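/- arXiv:2403.20167 — 6 statements merged into one kernel-verified Lean document; each statement's English description precedes it below -/
import Mathlib

section
/- With ρ and the operators B_i, C_i, A_i' = B_i ∘ C_i as in the context: for every smooth compactly supported function g : ℝ^n → ℂ and every i ∈ {1,…,n}, the function A_i'(g) is smooth and compactly supported. -/
open Complex Real MeasureTheory Set

noncomputable section

/-- The operator `C_i(g)(x) = g(x) − ρ(x_i)·∫_ℝ g(x; i↦y) dy`. -/
def Cop {n : ℕ} (ρ : ℝ → ℝ) (i : Fin n) (g : (Fin n → ℝ) → ℂ) : (Fin n → ℝ) → ℂ :=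
  fun x => g x - (ρ (x i) : ℂ) * ∫ y : ℝ, g (Function.update x i y)

/-- The operator `B_i(g)(x) = −∫_{−∞}^{x_i} g(x; i↦y) dy`. -/
def Bop {n : ℕ} (i : Fin n) (g : (Fin n → ℝ) → ℂ) : (Fin n → ℝ) → ℂ :=
  fun x => -∫ y in Set.Iic (x i), g (Function.update x i y)

/-- The operator `A_i' = B_i ∘ C_i`. -/
def Aop' {n : ℕ} (ρ : ℝ → ℝ) (i : Fin n) (g : (Fin n → ℝ) → ℂ) : (Fin n → ℝ) → ℂ :=
  Bop i (Cop ρ i g)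

lemma aux_update {n : ℕ} (i : Fin n) (h : (Fin n → ℝ) → ℂ) (hh : ContDiff ℝ (⊤ : ℕ∞) h) :
    ContDiff ℝ (⊤ : ℕ∞) (fun p : (Fin n → ℝ) × ℝ => h (Function.update p.1 i p.2)) := by
  apply hh.comp
  rw [contDiff_pi]
  intro j
  by_cases hj : j = i
  · subst hj
    simpa using contDiff_snd
  · simp only [Function.update_of_ne hj]
    fun_prop

lemma aux_conv {n : ℕ} (i : Fin n) (h : (Fin n → ℝ) → ℂ) (hh : ContDiff ℝ (⊤ : ℕ∞) h)
    (R : ℝ) (hR : ∀ x j, R < |x j| → h x = 0) (S : Set ℝ) (hS : MeasurableSet S)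
    (v : (Fin n → ℝ) → ℝ) (hv : ContDiff ℝ (⊤ : ℕ∞) v) :
    ContDiff ℝ (⊤ : ℕ∞) (fun x => ∫ y : ℝ, S.indicator (fun _ => (1 : ℝ)) (v x - y) •
      h (Function.update x i y)) := by
  have hf : LocallyIntegrable (S.indicator (fun _ => (1 : ℝ))) volume :=
    (locallyIntegrable_const (1 : ℝ)).indicator hS
  have key := contDiffOn_convolution_right_with_param_comp (𝕜 := ℝ) (μ := volume) (n := ⊤)
    (ContinuousLinearMap.lsmul ℝ ℝ) (s := univ) (v := v) hv.contDiffOn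
    (f := S.indicator (fun _ => (1 : ℝ)))
    (g := fun (x : Fin n → ℝ) (y : ℝ) => h (Function.update x i y))
    (k := Icc (-R) R) isOpen_univ isCompact_Icc
    (by
      intro p x _ hx
      apply hR _ i
      rw [Function.update_self]
      by_contra hc
      exact hx (abs_le.mp (not_lt.mp hc)))
    hf (aux_update i h hh).contDiffOn
  rw [contDiffOn_univ] at key
  convert key using 2 with x
  rw [convolution_def, ← integral_sub_left_eq_self _ volume (v x)]
  simp

lemma aux_int {n : ℕ} (i : Fin n) (h : (Fin n → ℝ) → ℂ) (hh : ContDiff ℝ (⊤ : ℕ∞) h)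
    (R : ℝ) (hR : ∀ x j, R < |x j| → h x = 0) :
    ContDiff ℝ (⊤ : ℕ∞) (fun x => ∫ y : ℝ, h (Function.update x i y)) := by
  have := aux_conv i h hh R hR univ MeasurableSet.univ (fun _ => 0) contDiff_const
  simpa using this

lemma aux_B {n : ℕ} (i : Fin n) (h : (Fin n → ℝ) → ℂ) (hh : ContDiff ℝ (⊤ : ℕ∞) h)
    (R : ℝ) (hR : ∀ x j, R < |x j| → h x = 0) :
    ContDiff ℝ (⊤ : ℕ∞) (Bop i h) := by
  have := (aux_conv i h hh R hR (Ici 0) measurableSet_Ici (fun x => x i)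
    (contDiff_apply ℝ ℝ i)).neg
  convert this using 2 with x
  unfold Bop
  congr 1
  rw [← integral_indicator measurableSet_Iic]
  congr 1
  ext y
  by_cases hy : y ≤ x i <;> simp [indicator, hy]

lemma aux_integrable {n : ℕ} (i : Fin n) (h : (Fin n → ℝ) → ℂ) (hh : ContDiff ℝ (⊤ : ℕ∞) h)
    (R : ℝ) (hR : ∀ x j, R < |x j| → h x = 0) (x : Fin n → ℝ) :
    Integrable (fun y : ℝ => h (Function.update x i y)) := by
  apply Continuous.integrable_of_hasCompactSupport
  · exact hh.continuous.comp (continuous_const.update i continuous_id)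
  · apply HasCompactSupport.intro (isCompact_Icc (a := -R) (b := R))
    intro y hy
    apply hR _ i
    rw [Function.update_self]
    by_contra hc
    exact hy (abs_le.mp (not_lt.mp hc))

lemma aux_cpt {n : ℕ} (h : (Fin n → ℝ) → ℂ)
    (R : ℝ) (hR : ∀ x j, R < |x j| → h x = 0) (j : Fin n) : HasCompactSupport h := by
  apply HasCompactSupport.intro (isCompact_univ_pi (fun _ : Fin n => isCompact_Icc (a := -R) (b := R)))
  intro x hx
  simp only [mem_univ_pi, not_forall] at hx
  obtain ⟨j, hj⟩ := hx
  apply hR x j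
  by_contra hc
  exact hj (abs_le.mp (not_lt.mp hc))

/-- with `ρ` a smooth compactly supported function of integral 1, for every
smooth compactly supported `g : ℝ^n → ℂ` and every `i`, the function `A_i'(g)` is smooth
and compactly supported. -/
theorem stmt4 {n : ℕ} (ρ : ℝ → ℝ)
    (hρ1 : ContDiff ℝ (⊤ : ℕ∞) ρ) (hρ2 : HasCompactSupport ρ) (hρ3 : ∫ t : ℝ, ρ t = 1)
    (g : (Fin n → ℝ) → ℂ) (hg1 : ContDiff ℝ (⊤ : ℕ∞) g) (hg2 : HasCompactSupport g) (i : Fin n) :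
    ContDiff ℝ (⊤ : ℕ∞) (Aop' ρ i g) ∧ HasCompactSupport (Aop' ρ i g) := by
  obtain ⟨R1, hR1, hg⟩ := hg2.exists_pos_le_norm
  obtain ⟨R2, hR2, hρ⟩ := hρ2.exists_pos_le_norm
  set R := max R1 R2
  have hgR : ∀ x j, R < |x j| → g x = 0 := by
    intro x j hx
    apply hg
    have h1 := norm_le_pi_norm x j
    rw [Real.norm_eq_abs] at h1
    exact ((le_max_left R1 R2).trans hx.le).trans h1
  have hρR : ∀ t, R < |t| → ρ t = 0 := by
    intro t ht
    apply hρ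
    rw [Real.norm_eq_abs]
    exact (le_max_right R1 R2).trans ht.le
  have hC : ContDiff ℝ (⊤ : ℕ∞) (Cop ρ i g) := by
    unfold Cop
    have h1 := aux_int i g hg1 R hgR
    have h2 : ContDiff ℝ (⊤ : ℕ∞) (fun x : Fin n → ℝ => (ρ (x i) : ℂ)) :=
      Complex.ofRealCLM.contDiff.comp (hρ1.comp (contDiff_apply ℝ ℝ i))
    exact hg1.sub (h2.mul h1)
  have hCR : ∀ x j, R < |x j| → Cop ρ i g x = 0 := by
    intro x j hx
    unfold Cop
    rw [hgR x j hx]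
    by_cases hj : j = i
    · subst hj
      simp [hρR _ hx]
    · have : ∀ y, g (Function.update x i y) = 0 := by
        intro y
        apply hgR _ j
        rwa [Function.update_of_ne hj]
      simp [this]
  refine ⟨aux_B i _ hC R hCR, aux_cpt _ R ?_ i⟩
  intro x j hx
  have hzero : ∫ y : ℝ, Cop ρ i g (Function.update x i y) = 0 := by
    unfold Cop
    simp only [Function.update_self, Function.update_idem]
    have hρi : Integrable (fun y => (ρ y : ℂ)) :=
      (hρ1.continuous.integrable_of_hasCompactSupport hρ2).ofReal
    rw [integral_sub (aux_integrable i g hg1 R hgR x) (hρi.mul_const _), integral_mul_const,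
      integral_complex_ofReal, hρ3]
    simp
  unfold Aop' Bop
  by_cases hj : j = i
  · subst hj
    rcases lt_abs.mp hx with h | h
    · rw [setIntegral_eq_integral_of_forall_compl_eq_zero, hzero, neg_zero]
      intro y hy
      apply hCR _ j
      rw [Function.update_self]
      simp only [mem_Iic, not_le] at hy
      exact lt_abs.mpr (Or.inl (h.trans hy))
    · rw [neg_eq_zero]
      apply setIntegral_eq_zero_of_forall_eq_zero
      intro y hy
      apply hCR _ j
      rw [Function.update_self]
      simp only [mem_Iic] at hy
      exact lt_abs.mpr (Or.inr (by linarith))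
  · have : ∀ y, Cop ρ i g (Function.update x i y) = 0 := by
      intro y
      apply hCR _ j
      rwa [Function.update_of_ne hj]
    simp [this]

end
end

section
/- With ρ and the operators D_i, E_i and A = ((Id−E_1)∘D_1)∘⋯∘((Id−E_n)∘D_n) as in the context: for every measurable bounded function u : ℝ^n → ℂ vanishing outside [−R,R]^n for some R > 0, the function A(u) is continuous on ℝ^n. -/
open Complex Real MeasureTheory Set

noncomputable section

/-- The operator `D_i(g)(x) = ∫_{−∞}^{x_i} g(x; i↦y) dy`. -/
def Dop {n : ℕ} (i : Fin n) (g : (Fin n → ℝ) → ℂ) : (Fin n → ℝ) → ℂ :=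
  fun x => ∫ y in Set.Iic (x i), g (Function.update x i y)

/-- The operator `E_i(g)(x) = ∫_ℝ g(x; i↦y)·ρ(y) dy`. -/
def Eop {n : ℕ} (ρ : ℝ → ℝ) (i : Fin n) (g : (Fin n → ℝ) → ℂ) : (Fin n → ℝ) → ℂ :=
  fun x => ∫ y : ℝ, g (Function.update x i y) * (ρ y : ℂ)

/-- The operator `A = ((Id−E_1)∘D_1)∘⋯∘((Id−E_n)∘D_n)`. -/
def Aop {n : ℕ} (ρ : ℝ → ℝ) (g : (Fin n → ℝ) → ℂ) : (Fin n → ℝ) → ℂ :=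
  (List.finRange n).foldr
    (fun i acc => fun x => Dop i acc x - Eop ρ i (Dop i acc) x) g

structure Good {n : ℕ} (R : ℝ) (S : Set (Fin n)) (g : (Fin n → ℝ) → ℂ) : Prop where
  meas : Measurable g
  bdd : ∃ M : ℝ, ∀ x, ‖g x‖ ≤ M
  supp : ∀ x, ∀ j, j ∉ S → x j ∉ Set.Icc (-R) R → g x = 0
  lip : ∀ j ∈ S, ∃ L : ℝ, 0 ≤ L ∧ ∀ x a b,
    ‖g (Function.update x j a) - g (Function.update x j b)‖ ≤ L * |a - b|

theorem meas_slice {n : ℕ} {g : (Fin n → ℝ) → ℂ} (hg : Measurable g) (i : Fin n) (x : Fin n → ℝ) :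
    Measurable (fun y => g (Function.update x i y)) :=
  hg.comp (measurable_update x)

theorem meas_joint {n : ℕ} {g : (Fin n → ℝ) → ℂ} (hg : Measurable g) (i : Fin n) :
    Measurable (fun p : (Fin n → ℝ) × ℝ => g (Function.update p.1 i p.2)) := by
  refine hg.comp (measurable_pi_lambda _ fun j => ?_)
  by_cases h : j = i
  · subst h; simpa using measurable_snd
  · simp only [Function.update_of_ne h]
    exact (measurable_pi_apply j).comp measurable_fst

theorem bound_integrable (R C : ℝ) :
    Integrable ((Set.Icc (-R) R).indicator (fun _ : ℝ => C)) := by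
  rw [integrable_indicator_iff measurableSet_Icc]
  exact integrableOn_const (by simp)

theorem Good.slice_int {n : ℕ} {R : ℝ} {S : Set (Fin n)} {g : (Fin n → ℝ) → ℂ}
    (h : Good R S g) {i : Fin n} (hi : i ∉ S) (x : Fin n → ℝ) :
    Integrable (fun y => g (Function.update x i y)) := by
  obtain ⟨M, hM⟩ := h.bdd
  refine (bound_integrable R M).mono' (meas_slice h.meas i x).aestronglyMeasurable
    (Filter.Eventually.of_forall fun y => ?_)
  by_cases hy : y ∈ Set.Icc (-R) R
  · rw [Set.indicator_of_mem hy]; exact hM _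
  · rw [Set.indicator_of_notMem hy, h.supp _ i hi (by simpa using hy)]; simp

theorem Good.D {n : ℕ} {R : ℝ} {S : Set (Fin n)} {g : (Fin n → ℝ) → ℂ} (hR : 0 < R)
    (h : Good R S g) {i : Fin n} (hi : i ∉ S) : Good R (insert i S) (Dop i g) := by
  obtain ⟨M, hM⟩ := h.bdd
  have hM0 : 0 ≤ M := (norm_nonneg _).trans (hM 0)
  refine ⟨?_, ?_, ?_, ?_⟩
  · have : Dop i g = fun x => ∫ y, (({p : (Fin n → ℝ) × ℝ | p.2 ≤ p.1 i}.indicator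
        (fun p => g (Function.update p.1 i p.2))) (x, y)) := by
      funext x
      rw [Dop, ← integral_indicator measurableSet_Iic]
      rfl
    rw [this]
    have hm : Measurable ({p : (Fin n → ℝ) × ℝ | p.2 ≤ p.1 i}.indicator
        (fun p => g (Function.update p.1 i p.2))) :=
      (meas_joint h.meas i).indicator
        (measurableSet_le measurable_snd ((measurable_pi_apply i).comp measurable_fst))
    exact hm.stronglyMeasurable.integral_prod_right'.measurable
  · refine ⟨∫ y, (Set.Icc (-R) R).indicator (fun _ : ℝ => M) y, fun x => ?_⟩
    have hn : ∀ y, ‖g (Function.update x i y)‖ ≤ (Set.Icc (-R) R).indicator (fun _ : ℝ => M) y := by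
      intro y
      by_cases hy : y ∈ Set.Icc (-R) R
      · rw [Set.indicator_of_mem hy]; exact hM _
      · rw [Set.indicator_of_notMem hy, h.supp _ i hi (by simpa using hy)]; simp
    refine (norm_integral_le_of_norm_le (bound_integrable R M).integrableOn
      (Filter.Eventually.of_forall hn)).trans ?_
    exact setIntegral_le_integral (bound_integrable R M)
      (Filter.Eventually.of_forall fun y => Set.indicator_nonneg (fun _ _ => hM0) y)
  · intro x j hj hx
    have hji : j ≠ i := fun e => hj (by simp [e])
    have hjS : j ∉ S := fun e => hj (by simp [e])
    have : ∀ y, g (Function.update x i y) = 0 := fun y =>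
      h.supp _ j hjS (by rwa [Function.update_of_ne hji])
    simp [Dop, this]
  · intro j hj
    by_cases hji : j = i
    · subst hji
      refine ⟨M, hM0, fun x a b => ?_⟩
      have hI := h.slice_int hi x
      simp only [Dop, Function.update_self, Function.update_idem]
      rw [intervalIntegral.integral_Iic_sub_Iic hI.integrableOn hI.integrableOn]
      exact intervalIntegral.norm_integral_le_of_norm_le_const fun y _ => hM _
    · have hjS : j ∈ S := by simpa [hji] using hj
      obtain ⟨L, hL0, hL⟩ := h.lip j hjS
      refine ⟨2 * R * L, by positivity, fun x a b => ?_⟩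
      simp only [Dop, Function.update_of_ne (Ne.symm hji)]
      rw [← integral_sub (h.slice_int hi _).integrableOn (h.slice_int hi _).integrableOn]
      have hn : ∀ y, ‖g (Function.update (Function.update x j a) i y)
          - g (Function.update (Function.update x j b) i y)‖
          ≤ (Set.Icc (-R) R).indicator (fun _ : ℝ => L * |a - b|) y := by
        intro y
        by_cases hy : y ∈ Set.Icc (-R) R
        · rw [Set.indicator_of_mem hy, Function.update_comm hji, Function.update_comm hji]
          exact hL _ _ _
        · rw [Set.indicator_of_notMem hy, h.supp _ i hi (by simpa using hy),
            h.supp _ i hi (by simpa using hy)]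
          simp
      refine (norm_integral_le_of_norm_le (bound_integrable R _).integrableOn
        (Filter.Eventually.of_forall hn)).trans ?_
      refine (setIntegral_le_integral (bound_integrable R _)
        (Filter.Eventually.of_forall fun y =>
          Set.indicator_nonneg (fun _ _ => by positivity) y)).trans ?_
      rw [integral_indicator measurableSet_Icc]
      have : max (R + R) 0 = 2 * R := by rw [max_eq_left (by positivity)]; ring
      simp [measureReal_def, ENNReal.toReal_ofReal', this]
      exact le_of_eq (by ring)

theorem Good.E {n : ℕ} {R : ℝ} {S : Set (Fin n)} {g : (Fin n → ℝ) → ℂ} {ρ : ℝ → ℝ}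
    (hρ : Integrable ρ) (hρm : Measurable ρ)
    (h : Good R S g) {i : Fin n} (hi : i ∈ S) : Good R S (Eop ρ i g) := by
  obtain ⟨M, hM⟩ := h.bdd
  have hM0 : 0 ≤ M := (norm_nonneg _).trans (hM 0)
  have hb : ∀ C : ℝ, Integrable (fun y => C * |ρ y|) := fun C => hρ.abs.const_mul C
  have hn : ∀ x y, ‖g (Function.update x i y) * (ρ y : ℂ)‖ ≤ M * |ρ y| := by
    intro x y
    rw [norm_mul, Complex.norm_real, Real.norm_eq_abs]
    exact mul_le_mul_of_nonneg_right (hM _) (abs_nonneg _)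
  have hint : ∀ x, Integrable (fun y => g (Function.update x i y) * (ρ y : ℂ)) := fun x =>
    (hb M).mono' ((meas_slice h.meas i x).mul
      (Complex.measurable_ofReal.comp hρm)).aestronglyMeasurable
      (Filter.Eventually.of_forall (hn x))
  refine ⟨?_, ?_, ?_, ?_⟩
  · have hm : Measurable (fun p : (Fin n → ℝ) × ℝ => g (Function.update p.1 i p.2) * (ρ p.2 : ℂ)) :=
      (meas_joint h.meas i).mul (Complex.measurable_ofReal.comp (hρm.comp measurable_snd))
    exact hm.stronglyMeasurable.integral_prod_right'.measurable
  · exact ⟨_, fun x => norm_integral_le_of_norm_le (hb M) (Filter.Eventually.of_forall (hn x))⟩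
  · intro x j hj hx
    have hji : j ≠ i := fun e => hj (by simpa [e] using hi)
    have : ∀ y, g (Function.update x i y) = 0 := fun y =>
      h.supp _ j hj (by rwa [Function.update_of_ne hji])
    simp [Eop, this]
  · intro j hj
    by_cases hji : j = i
    · subst hji
      exact ⟨0, le_rfl, fun x a b => by simp [Eop]⟩
    · obtain ⟨L, hL0, hL⟩ := h.lip j hj
      refine ⟨L * ∫ y, |ρ y|, mul_nonneg hL0 (integral_nonneg fun _ => abs_nonneg _),
        fun x a b => ?_⟩
      simp only [Eop]
      rw [← integral_sub (hint _) (hint _)]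
      refine (norm_integral_le_of_norm_le (hb (L * |a - b|))
        (Filter.Eventually.of_forall fun y => ?_)).trans ?_
      · rw [← sub_mul, norm_mul, Complex.norm_real, Real.norm_eq_abs,
          Function.update_comm hji, Function.update_comm hji]
        exact mul_le_mul_of_nonneg_right (hL _ _ _) (abs_nonneg _)
      · rw [integral_const_mul]
        exact le_of_eq (by ring)

theorem Good.sub {n : ℕ} {R : ℝ} {S : Set (Fin n)} {f g : (Fin n → ℝ) → ℂ}
    (hf : Good R S f) (hg : Good R S g) : Good R S (fun x => f x - g x) := by
  obtain ⟨M, hM⟩ := hf.bdd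
  obtain ⟨N, hN⟩ := hg.bdd
  refine ⟨hf.meas.sub hg.meas,
    ⟨M + N, fun x => (norm_sub_le _ _).trans (add_le_add (hM x) (hN x))⟩, ?_, ?_⟩
  · intro x j hj hx
    simp [hf.supp x j hj hx, hg.supp x j hj hx]
  · intro j hj
    obtain ⟨L, hL0, hL⟩ := hf.lip j hj
    obtain ⟨K, hK0, hK⟩ := hg.lip j hj
    refine ⟨L + K, by positivity, fun x a b => ?_⟩
    rw [sub_sub_sub_comm, add_mul]
    exact (norm_sub_le _ _).trans (add_le_add (hL x a b) (hK x a b))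

theorem Good.fold {n : ℕ} {R : ℝ} {u : (Fin n → ℝ) → ℂ} {ρ : ℝ → ℝ} (hR : 0 < R)
    (hρ : Integrable ρ) (hρm : Measurable ρ) (h : Good R ∅ u) :
    ∀ l : List (Fin n), l.Nodup → Good R {j | j ∈ l} (l.foldr
    (fun i acc => fun x => Dop i acc x - Eop ρ i (Dop i acc) x) u)
  | [], _ => by simpa using h
  | i :: l, hl => by
    rw [List.nodup_cons] at hl
    have ih := Good.fold hR hρ hρm h l hl.2
    have hD := ih.D hR (i := i) hl.1
    have hS : {j | j ∈ i :: l} = insert i {j | j ∈ l} := by ext j; simp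
    rw [hS]
    exact hD.sub (hD.E hρ hρm (Set.mem_insert _ _))

theorem Good.cont {n : ℕ} {R : ℝ} {g : (Fin n → ℝ) → ℂ} {S : Set (Fin n)}
    (h : Good R S g) (hS : ∀ j, j ∈ S) : Continuous g := by
  choose L hL0 hL using fun j => h.lip j (hS j)
  have key : ∀ (x y : Fin n → ℝ) (s : Finset (Fin n)),
      ‖g (s.piecewise y x) - g x‖ ≤ ∑ j ∈ s, L j * |y j - x j| := by
    intro x y s
    induction s using Finset.induction_on with
    | empty => simp
    | insert j s hj ih =>
      rw [Finset.sum_insert hj, Finset.piecewise_insert]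
      have h1 := hL j (s.piecewise y x) (y j) (x j)
      have h2 : Function.update (s.piecewise y x) j (x j) = s.piecewise y x := by
        rw [Function.update_eq_self_iff, Finset.piecewise_eq_of_notMem _ _ _ hj]
      rw [h2] at h1
      exact (norm_sub_le_norm_sub_add_norm_sub _ _ _).trans (add_le_add h1 ih)
  rw [continuous_iff_continuousAt]
  intro x
  rw [ContinuousAt, tendsto_iff_norm_sub_tendsto_zero]
  have hc : Continuous fun y : Fin n → ℝ => ∑ j, L j * |y j - x j| := by fun_prop
  have ht := hc.tendsto x
  simp only [sub_self, abs_zero, mul_zero, Finset.sum_const_zero] at ht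
  refine squeeze_zero (fun _ => norm_nonneg _) (fun y => ?_) ht
  simpa using key x y Finset.univ

/-- with `ρ` a smooth compactly supported function of integral 1, for every
measurable bounded `u : ℝ^n → ℂ` vanishing outside `[−R,R]^n` for some `R > 0`, the
function `A(u)` is continuous on `ℝ^n`. -/
theorem stmt7 {n : ℕ} (ρ : ℝ → ℝ)
    (hρ1 : ContDiff ℝ (⊤ : ℕ∞) ρ) (hρ2 : HasCompactSupport ρ) (hρ3 : ∫ t : ℝ, ρ t = 1)
    (u : (Fin n → ℝ) → ℂ) (hmeas : Measurable u)
    (hbdd : ∃ M : ℝ, ∀ y, ‖u y‖ ≤ M)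
    (R : ℝ) (hR : 0 < R)
    (hsupp : ∀ y : Fin n → ℝ,
      y ∉ Set.univ.pi (fun _ : Fin n => Set.Icc (-R) R) → u y = 0) :
    Continuous (Aop ρ u) := by
  have hc : Continuous ρ := hρ1.continuous
  have h0 : Good R ∅ u := by
    refine ⟨hmeas, hbdd, fun x j _ hx => hsupp x fun hm => hx (hm j (Set.mem_univ _)), ?_⟩
    intro j hj
    exact absurd hj (Set.notMem_empty j)
  exact (Good.fold hR (hc.integrable_of_hasCompactSupport hρ2) hc.measurable h0
    (List.finRange n) (List.nodup_finRange n)).cont fun j => List.mem_finRange j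

end
end

section
/- With ρ and the operators A_i' = B_i ∘ C_i, D_i, E_i as in the context: let u : ℝ^n → ℂ be integrable with compact support, let f : ℝ^n → ℂ be smooth with compact support, and let i ∈ {1,…,n}. Then ∫_{ℝ^n} u(x)·A_i'(f)(x) dx = ∫_{ℝ^n} (D_i(u)(x) − E_i(D_i(u))(x))·f(x) dx, both integrals being absolutely convergent. Equivalently, the anti-derivative distribution A_i(u), defined by ⟨A_i(u), f⟩ = ⟨u, A_i'(f)⟩, is represented by the function (Id − E_i)(D_i(u)). -/
open Complex Real MeasureTheory Set

noncomputable section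

lemma aux_left (ρ : ℝ → ℝ) (hρ : Integrable ρ) (φ : ℝ → ℂ) (hφ : Integrable φ) (t : ℝ) :
    (-∫ s in Set.Iic t, (φ s - (ρ s : ℂ) * ∫ y, φ y)) =
      ∫ s, (((∫ r in Set.Iic t, ρ r : ℝ) : ℂ) - (Set.Iic t).indicator 1 s) * φ s := by
  have hρc : Integrable (fun r => (ρ r : ℂ)) := hρ.ofReal
  have h1 : ∀ s, (((∫ r in Set.Iic t, ρ r : ℝ) : ℂ) - (Set.Iic t).indicator 1 s) * φ s
      = ((∫ r in Set.Iic t, ρ r : ℝ) : ℂ) * φ s - (Set.Iic t).indicator φ s := by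
    intro s
    by_cases hs : s ∈ Set.Iic t <;> simp [Set.indicator, hs, sub_mul]
  simp_rw [h1]
  rw [integral_sub (hφ.const_mul _) (hφ.indicator measurableSet_Iic),
    integral_indicator measurableSet_Iic, integral_const_mul,
    integral_sub hφ.integrableOn (hρc.mul_const _).integrableOn,
    integral_mul_const, integral_complex_ofReal]
  ring

lemma aux_right (ρ : ℝ → ℝ) (hρ : Integrable ρ) (hρ3 : ∫ t : ℝ, ρ t = 1)
    (v : ℝ → ℂ) (hv : Integrable v) (s : ℝ) :
    (∫ t in Set.Iic s, v t) - ∫ r, (∫ t in Set.Iic r, v t) * (ρ r : ℂ) =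
      ∫ t, (((∫ r in Set.Iic t, ρ r : ℝ) : ℂ) - (Set.Iic t).indicator 1 s) * v t := by
  have hρc : Integrable (fun r => (ρ r : ℂ)) := hρ.ofReal
  have hms : MeasurableSet {p : ℝ × ℝ | p.2 ≤ p.1} := measurableSet_le measurable_snd measurable_fst
  have hI : Integrable (fun p : ℝ × ℝ => {p : ℝ × ℝ | p.2 ≤ p.1}.indicator
      (fun p => (ρ p.1 : ℂ) * v p.2) p) (volume.prod volume) :=
    (hρc.mul_prod hv).indicator hms
  have e1 : ∫ r, (∫ t in Set.Iic r, v t) * (ρ r : ℂ) =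
      ∫ r, ∫ t, {p : ℝ × ℝ | p.2 ≤ p.1}.indicator (fun p => (ρ p.1 : ℂ) * v p.2) (r, t) := by
    congr 1; ext r
    rw [← integral_indicator measurableSet_Iic, mul_comm, ← integral_const_mul]
    congr 1; ext t
    by_cases h : t ≤ r <;> simp [Set.indicator, h]
  have e2 : ∀ t, ∫ r, {p : ℝ × ℝ | p.2 ≤ p.1}.indicator (fun p => (ρ p.1 : ℂ) * v p.2) (r, t)
      = (1 - ((∫ r in Set.Iic t, ρ r : ℝ) : ℂ)) * v t := by
    intro t
    have : ∀ r, {p : ℝ × ℝ | p.2 ≤ p.1}.indicator (fun p => (ρ p.1 : ℂ) * v p.2) (r, t)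
        = (Set.Ici t).indicator (fun r => (ρ r : ℂ)) r * v t := by
      intro r
      by_cases h : t ≤ r <;> simp [Set.indicator, h]
    simp_rw [this]
    rw [integral_mul_const, integral_indicator measurableSet_Ici, integral_Ici_eq_integral_Ioi,
      integral_complex_ofReal]
    congr 1
    have h := intervalIntegral.integral_Iic_add_Ioi (b := t) hρ.integrableOn hρ.integrableOn
    rw [hρ3] at h
    rw [eq_sub_iff_add_eq', ← Complex.ofReal_add, h, Complex.ofReal_one]
  have hI2 := hI.integral_prod_right
  simp only [e2] at hI2
  rw [e1, integral_integral_swap (f := fun r t => {p : ℝ × ℝ | p.2 ≤ p.1}.indicator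
    (fun p => (ρ p.1 : ℂ) * v p.2) (r, t)) hI]
  simp_rw [e2]
  rw [← integral_indicator measurableSet_Iic,
    ← integral_sub (hv.indicator measurableSet_Iic) hI2]
  apply integral_congr_ae
  have : ∀ᵐ t : ℝ, t ≠ s := by simp [ae_iff]
  filter_upwards [this] with t ht
  rcases lt_or_gt_of_ne ht with h | h
  · simp [Set.indicator, h.le, h.not_ge]; ring
  · simp [Set.indicator, h.le, h.not_ge]; ring

/-- The map swapping the two real variables. -/
def sw {Y : Type*} (q : (ℝ × Y) × ℝ) : (ℝ × Y) × ℝ := ((q.2, q.1.2), q.1.1)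

lemma sw_mp {Y : Type*} [MeasureSpace Y] [SigmaFinite (volume : Measure Y)] :
    MeasurePreserving (sw (Y := Y)) ((volume.prod volume).prod volume)
      ((volume.prod volume).prod volume) := by
  have h1 := measurePreserving_prodAssoc (volume : Measure ℝ) (volume : Measure Y)
    (volume : Measure ℝ)
  have h2 := Measure.measurePreserving_swap (μ := (volume : Measure ℝ))
    (ν := (volume : Measure Y).prod (volume : Measure ℝ))
  have h3 := (Measure.measurePreserving_swap (μ := (volume : Measure Y))
    (ν := (volume : Measure ℝ))).prod (MeasurePreserving.id (volume : Measure ℝ))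
  exact (h3.comp (h2.comp h1))

lemma aux_prod {Y : Type*} [MeasureSpace Y] [SigmaFinite (volume : Measure Y)]
    (ρ : ℝ → ℝ) (hρ : Integrable ρ) (hρ3 : ∫ t : ℝ, ρ t = 1)
    (U F : ℝ × Y → ℂ) (hU : Integrable U (volume.prod volume))
    (hF : Measurable F) (M L : ℝ) (hM : ∀ p, ‖F p‖ ≤ M)
    (hL : ∀ p : ℝ × Y, p.1 ∉ Set.Icc (-L) L → F p = 0) :
    let P : ℝ × Y → ℂ := fun p => U p *
      (-∫ s in Set.Iic p.1, (F (s, p.2) - (ρ s : ℂ) * ∫ y, F (y, p.2)))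
    let Q : ℝ × Y → ℂ := fun p =>
      ((∫ t in Set.Iic p.1, U (t, p.2)) - ∫ r, (∫ t in Set.Iic r, U (t, p.2)) * (ρ r : ℂ)) * F p
    Integrable P (volume.prod volume) ∧ Integrable Q (volume.prod volume) ∧
      ∫ p, P p ∂(volume.prod volume) = ∫ p, Q p ∂(volume.prod volume) := by
  intro P Q
  set R : ℝ → ℝ := fun t => ∫ r in Set.Iic t, ρ r with hR
  have hRm : Measurable R := by
    have : Continuous R := by
      have h := intervalIntegral.continuous_primitive (f := ρ) (μ := volume)
        (fun a b => hρ.intervalIntegrable) 0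
      have h2 : R = fun t => (∫ r in Set.Iic 0, ρ r) + ∫ r in (0:ℝ)..t, ρ r := by
        ext t
        rw [← intervalIntegral.integral_Iic_sub_Iic hρ.integrableOn hρ.integrableOn]
        ring
      rw [h2]; exact continuous_const.add h
    exact this.measurable
  have hRb : ∀ t, ‖R t‖ ≤ ∫ r, ‖ρ r‖ := fun t =>
    (norm_integral_le_integral_norm _).trans
      (setIntegral_le_integral hρ.norm (Filter.Eventually.of_forall fun _ => norm_nonneg _))
  set k : ℝ → ℝ → ℂ := fun t s => ((R t : ℝ) : ℂ) - (Set.Iic t).indicator 1 s with hk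
  have hkm : Measurable (fun q : (ℝ × Y) × ℝ => k q.1.1 q.2) := by
    apply Measurable.sub
    · exact Complex.measurable_ofReal.comp (hRm.comp (measurable_fst.comp measurable_fst))
    · have : (fun q : (ℝ × Y) × ℝ => (Set.Iic q.1.1).indicator (1 : ℝ → ℂ) q.2) =
          {q : (ℝ × Y) × ℝ | q.2 ≤ q.1.1}.indicator 1 := by
        ext q; simp [Set.indicator]
      rw [this]
      exact measurable_one.indicator
        (measurableSet_le measurable_snd (measurable_fst.comp measurable_fst))
  have hkb : ∀ t s, ‖k t s‖ ≤ (∫ r, ‖ρ r‖) + 1 := by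
    intro t s
    refine (norm_sub_le _ _).trans (add_le_add ?_ ?_)
    · simpa using hRb t
    · by_cases h : s ≤ t <;> simp [Set.indicator, h]
  set G : (ℝ × Y) × ℝ → ℂ := fun q => k q.1.1 q.2 * F (q.2, q.1.2) * U q.1 with hG
  have hGi : Integrable G ((volume.prod volume).prod volume) := by
    have hind : Integrable ((Set.Icc (-L) L).indicator (1 : ℝ → ℂ)) :=
      (integrable_indicator_iff measurableSet_Icc).2
        (integrableOn_const (by simp) (by simp))
    have h := hU.mul_prod hind
    have h' := h.bdd_mul (c := ((∫ r, ‖ρ r‖) + 1) * M)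
      (f := fun q : (ℝ × Y) × ℝ => k q.1.1 q.2 * F (q.2, q.1.2))
      (hkm.mul (hF.comp (measurable_snd.prodMk
        (measurable_snd.comp measurable_fst)))).aestronglyMeasurable
      (Filter.Eventually.of_forall fun q => by
        rw [norm_mul]
        exact mul_le_mul (hkb _ _) (hM _) (norm_nonneg _)
          ((norm_nonneg _).trans (hkb 0 0)))
    refine h'.congr (Filter.Eventually.of_forall fun q => ?_)
    by_cases hq : q.2 ∈ Set.Icc (-L) L
    · simp only [hG, Set.indicator_of_mem hq]; simp
    · simp only [hG, hL (q.2, q.1.2) hq]; simp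
  have hFi : ∀ y, Integrable (fun s => F (s, y)) := by
    intro y
    have h1 : IntegrableOn (fun s => F (s, y)) (Set.Icc (-L) L) :=
      Measure.integrableOn_of_bounded (M := M) (by simp)
        (hF.comp measurable_prodMk_right).aestronglyMeasurable
        (Filter.Eventually.of_forall fun s => hM _)
    refine (integrableOn_iff_integrable_of_support_subset ?_).1 h1
    intro s hs
    by_contra h
    exact hs (hL (s, y) h)
  have hP : ∀ p, ∫ s, G (p, s) = P p := by
    intro p
    simp only [P]
    rw [aux_left ρ hρ (fun s => F (s, p.2)) (hFi p.2) p.1, mul_comm, ← integral_mul_const]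
  have hGs : Integrable (fun q => G (sw q)) ((volume.prod volume).prod volume) :=
    sw_mp.integrable_comp_of_integrable hGi
  have hQ : ∀ᵐ p : ℝ × Y ∂(volume.prod volume), ∫ t, G (sw (p, t)) = Q p := by
    have h := hU.prod_left_ae
    have h2 := Measure.quasiMeasurePreserving_snd (μ := (volume : Measure ℝ))
      (ν := (volume : Measure Y)) |>.ae h
    filter_upwards [h2] with p hp
    simp only [Q]
    rw [aux_right ρ hρ hρ3 (fun t => U (t, p.2)) hp p.1, ← integral_mul_const]
    congr 1; ext t
    simp only [hG, sw, hk, hR]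
    ring
  refine ⟨?_, ?_, ?_⟩
  · exact hGi.integral_prod_left.congr (Filter.Eventually.of_forall hP)
  · exact hGs.integral_prod_left.congr hQ
  · rw [← integral_congr_ae hQ, ← integral_prod _ hGs]
    simp_rw [← hP]
    rw [← integral_prod _ hGi]
    have hinv : Function.Involutive (sw (Y := Y)) := fun q => rfl
    have hm : Measurable (sw (Y := Y)) := sw_mp.measurable
    exact (sw_mp.integral_comp (MeasurableEquiv.measurableEmbedding
      ⟨hinv.toPerm, hm, hm⟩) G).symm

/-- with `ρ` a smooth compactly supported function of integral 1: for `u`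
integrable with compact support, `f` smooth with compact support and any coordinate `i`,
both `u·A_i'(f)` and `((Id−E_i)∘D_i)(u)·f` are integrable and
`∫ u(x)·A_i'(f)(x) dx = ∫ (D_i(u)(x) − E_i(D_i(u))(x))·f(x) dx`; that is, the
anti-derivative distribution `A_i(u)` is represented by the function `(Id−E_i)(D_i(u))`. -/
theorem stmt8 {n : ℕ} (ρ : ℝ → ℝ)
    (hρ1 : ContDiff ℝ (⊤ : ℕ∞) ρ) (hρ2 : HasCompactSupport ρ) (hρ3 : ∫ t : ℝ, ρ t = 1)
    (u : (Fin n → ℝ) → ℂ) (hu : Integrable u (volume : Measure (Fin n → ℝ)))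
    (husupp : HasCompactSupport u)
    (f : (Fin n → ℝ) → ℂ) (hf1 : ContDiff ℝ (⊤ : ℕ∞) f) (hf2 : HasCompactSupport f)
    (i : Fin n) :
    Integrable (fun x => u x * Aop' ρ i f x) (volume : Measure (Fin n → ℝ)) ∧
    Integrable (fun x => (Dop i u x - Eop ρ i (Dop i u) x) * f x)
      (volume : Measure (Fin n → ℝ)) ∧
    ∫ x : Fin n → ℝ, u x * Aop' ρ i f x =
      ∫ x : Fin n → ℝ, (Dop i u x - Eop ρ i (Dop i u) x) * f x := by
  obtain ⟨m, rfl⟩ : ∃ m, n = m + 1 := ⟨n - 1, by have := i.pos; omega⟩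
  have hρ : Integrable ρ := hρ1.continuous.integrable_of_hasCompactSupport hρ2
  have mp := (volume_preserving_piFinSuccAbove (fun _ : Fin (m + 1) => ℝ) i).symm
  set e := (MeasurableEquiv.piFinSuccAbove (fun _ : Fin (m + 1) => ℝ) i).symm with he
  have hev : ∀ p, e p = i.insertNth p.1 p.2 := fun p => rfl
  have hup : ∀ (p : ℝ × (Fin m → ℝ)) s, Function.update (e p) i s = e (s, p.2) := by
    intro p s
    simp [hev]
  have hei : ∀ p : ℝ × (Fin m → ℝ), e p i = p.1 := by
    intro p; simp [hev]
  obtain ⟨M, hM⟩ := hf2.exists_bound_of_continuous hf1.continuous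
  obtain ⟨L, hL⟩ := hf2.isCompact.isBounded.exists_norm_le
  have hUi : Integrable (fun p => u (e p)) (volume.prod volume) :=
    (mp.integrable_comp_emb e.measurableEmbedding).2 hu
  have key := aux_prod ρ hρ hρ3 (fun p => u (e p)) (fun p => f (e p)) hUi
    (hf1.continuous.measurable.comp e.measurable) M L (fun p => hM _) (by
      intro p hp
      by_contra h
      have h1 := hL (e p) (subset_tsupport _ h)
      have h2 := (norm_le_pi_norm (e p) i).trans h1
      rw [hei, Real.norm_eq_abs, abs_le] at h2
      exact hp h2)
  have eP : ∀ p : ℝ × (Fin m → ℝ), u (e p) * Aop' ρ i f (e p) = u (e p) *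
      (-∫ s in Set.Iic p.1, (f (e (s, p.2)) - (ρ s : ℂ) * ∫ y, f (e (y, p.2)))) := by
    intro p
    simp only [Aop', Bop, Cop, hup, hei]
  have eQ : ∀ p : ℝ × (Fin m → ℝ), (Dop i u (e p) - Eop ρ i (Dop i u) (e p)) * f (e p) =
      ((∫ t in Set.Iic p.1, u (e (t, p.2))) -
        ∫ r, (∫ t in Set.Iic r, u (e (t, p.2))) * (ρ r : ℂ)) * f (e p) := by
    intro p
    simp only [Dop, Eop, hup, hei]
  simp only [← eP, ← eQ] at key
  obtain ⟨k1, k2, k3⟩ := key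
  refine ⟨(mp.integrable_comp_emb e.measurableEmbedding).1 k1,
    (mp.integrable_comp_emb e.measurableEmbedding).1 k2, ?_⟩
  rw [← mp.integral_comp e.measurableEmbedding, ← mp.integral_comp e.measurableEmbedding]
  exact k3

end
end

section
/- With ρ and the operator A' = A_1'∘⋯∘A_n' as in the context: let K_0 ⊆ ℝ be a compact interval containing the support of ρ, let m ∈ ℕ, and let g : ℝ^n → ℂ be of class C^m with g(x) = 0 for all x outside K_0^n. Then A'(g) is of class C^{m+1} and A'(g)(x) = 0 for all x outside K_0^n. -/
open Complex Real MeasureTheory Set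

noncomputable section

/-- The operator `A' = A_1'∘⋯∘A_n'`. -/
def Aop'full {n : ℕ} (ρ : ℝ → ℝ) (g : (Fin n → ℝ) → ℂ) : (Fin n → ℝ) → ℂ :=
  (List.finRange n).foldr (fun i acc => Aop' ρ i acc) g

/-- line derivatives that are continuous give a Frechet derivative. -/
lemma aux_partial {n : ℕ} (f : (Fin n → ℝ) → ℂ) (p : Fin n → (Fin n → ℝ) → ℂ)
    (hp : ∀ j, Continuous (p j))
    (h : ∀ j x, HasLineDerivAt ℝ f (p j x) x (Pi.single j 1)) (S : Finset (Fin n)) :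
    ∀ x v : Fin n → ℝ, HasFDerivAt
      (fun v : Fin n → ℝ => f (x + ∑ j ∈ S, v j • (Pi.single j 1 : Fin n → ℝ)))
      (∑ j ∈ S, (ContinuousLinearMap.proj (R := ℝ) (φ := fun _ : Fin n => ℝ) j).smulRight
        (p j (x + ∑ j ∈ S, v j • (Pi.single j 1 : Fin n → ℝ)))) v := by
  classical
  induction S using Finset.induction_on with
  | empty =>
    intro x v
    simpa using hasFDerivAt_const (f x) v
  | insert i S hi ih =>
    intro x v
    have key := hasStrictFDerivAt_uncurry_coprod (𝕜 := ℝ) (E₁ := Fin n → ℝ) (E₂ := ℝ) (F := ℂ)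
      (u := (v, v i))
      (f := fun w s => f (x + s • (Pi.single i 1 : Fin n → ℝ)
        + ∑ j ∈ S, w j • (Pi.single j 1 : Fin n → ℝ)))
      (f₁ := fun w s => ∑ j ∈ S,
        (ContinuousLinearMap.proj (R := ℝ) (φ := fun _ : Fin n => ℝ) j).smulRight
        (p j (x + s • (Pi.single i 1 : Fin n → ℝ)
          + ∑ j ∈ S, w j • (Pi.single j 1 : Fin n → ℝ))))
      (f₂ := fun w s => (ContinuousLinearMap.id ℝ ℝ).smulRight
        (p i (x + s • (Pi.single i 1 : Fin n → ℝ)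
          + ∑ j ∈ S, w j • (Pi.single j 1 : Fin n → ℝ))))
      (Filter.Eventually.of_forall fun u => ih (x + u.2 • (Pi.single i 1 : Fin n → ℝ)) u.1)
      (Filter.Eventually.of_forall fun u => by
        have h1 := h i (x + u.2 • (Pi.single i 1 : Fin n → ℝ)
          + ∑ j ∈ S, u.1 j • (Pi.single j 1 : Fin n → ℝ))
        have h2 : HasDerivAt (fun s : ℝ => f (x + s • (Pi.single i 1 : Fin n → ℝ)
          + ∑ j ∈ S, u.1 j • (Pi.single j 1 : Fin n → ℝ))) (p i (x + u.2 • (Pi.single i 1 : Fin n → ℝ)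
          + ∑ j ∈ S, u.1 j • (Pi.single j 1 : Fin n → ℝ))) u.2 := by
          unfold HasLineDerivAt at h1
          have h3 : HasDerivAt (fun s : ℝ => s - u.2) 1 u.2 := (hasDerivAt_id _).sub_const _
          have h1' : HasDerivAt (fun t : ℝ => f (x + u.2 • (Pi.single i 1 : Fin n → ℝ)
            + ∑ j ∈ S, u.1 j • (Pi.single j 1 : Fin n → ℝ) + t • (Pi.single i 1 : Fin n → ℝ)))
            (p i (x + u.2 • (Pi.single i 1 : Fin n → ℝ)
            + ∑ j ∈ S, u.1 j • (Pi.single j 1 : Fin n → ℝ))) (u.2 - u.2) := by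
            rw [sub_self]; exact h1
          have h4 := HasDerivAt.scomp (h := fun s : ℝ => s - u.2) u.2 h1' h3
          rw [one_smul] at h4
          refine h4.congr_of_eventuallyEq (Filter.Eventually.of_forall fun s => ?_)
          simp only [Function.comp]
          congr 1
          module
        have h5 := h2.hasFDerivAt
        refine h5.congr_fderiv ?_
        ext
        simp [Function.HasUncurry.uncurry])
      (by
        apply Continuous.continuousAt
        simp only [Function.HasUncurry.uncurry]
        have := hp
        refine continuous_finsetSum _ fun j _ => ?_
        refine (ContinuousLinearMap.smulRightL ℝ (Fin n → ℝ) ℂ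
          (ContinuousLinearMap.proj (R := ℝ) (φ := fun _ : Fin n => ℝ) j)).continuous.comp ?_
        fun_prop)
      (by
        apply Continuous.continuousAt
        simp only [Function.HasUncurry.uncurry]
        have := hp
        refine (ContinuousLinearMap.smulRightL ℝ ℝ ℂ
          (ContinuousLinearMap.id ℝ ℝ)).continuous.comp ?_
        fun_prop)
    have hL : HasFDerivAt (fun w : Fin n → ℝ => (w, w i))
      ((ContinuousLinearMap.id ℝ (Fin n → ℝ)).prod
        (ContinuousLinearMap.proj (R := ℝ) (φ := fun _ : Fin n => ℝ) i)) v :=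
      ((ContinuousLinearMap.id ℝ (Fin n → ℝ)).prod
        (ContinuousLinearMap.proj (R := ℝ) (φ := fun _ : Fin n => ℝ) i)).hasFDerivAt
    have key2 := HasFDerivAt.comp v (g := Function.HasUncurry.uncurry fun (w : Fin n → ℝ) (s : ℝ) =>
        f (x + s • (Pi.single i 1 : Fin n → ℝ)
        + ∑ j ∈ S, w j • (Pi.single j 1 : Fin n → ℝ))) key.hasFDerivAt hL
    refine (key2.congr_of_eventuallyEq (Filter.Eventually.of_forall fun s => ?_)).congr_fderiv ?_
    · simp only [Function.comp, Function.HasUncurry.uncurry, id, Finset.sum_insert hi, add_assoc]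
    · ext w
      simp only [Finset.sum_insert hi, add_assoc]
      simp [Function.HasUncurry.uncurry, add_comm, add_assoc, add_left_comm]

lemma aux_contDiff_succ {n : ℕ} (m : ℕ) (f : (Fin n → ℝ) → ℂ) (p : Fin n → (Fin n → ℝ) → ℂ)
    (hp : ∀ j, ContDiff ℝ m (p j))
    (h : ∀ j x, HasLineDerivAt ℝ f (p j x) x (Pi.single j 1)) :
    ContDiff ℝ (m + 1) f := by
  have hd : ∀ v, HasFDerivAt f (∑ j,
      (ContinuousLinearMap.proj (R := ℝ) (φ := fun _ : Fin n => ℝ) j).smulRight (p j v)) v := by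
    intro v
    have := aux_partial f p (fun j => (hp j).continuous) h Finset.univ 0 v
    have e : ∀ v : Fin n → ℝ, (0 : Fin n → ℝ) + ∑ j, v j • (Pi.single j 1 : Fin n → ℝ) = v := by
      intro v
      rw [zero_add]
      ext k
      simp [Finset.sum_apply, Pi.single_apply]
    simpa only [e] using this
  rw [contDiff_succ_iff_fderiv_apply]
  refine ⟨fun v => (hd v).differentiableAt, by simp, fun w => ?_⟩
  have : (fun v => fderiv ℝ f v w) = fun v => ∑ j, w j • p j v := by
    ext v
    rw [(hd v).fderiv]
    simp
  rw [this]
  exact ContDiff.sum fun j _ => (hp j).const_smul _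

/-- differentiation under the integral along a line. -/
lemma aux_line_int (a b : ℝ) (F F' : ℝ → ℝ → ℂ)
    (hF : ∀ s, Continuous (F s)) (hF' : Continuous (fun q : ℝ × ℝ => F' q.1 q.2))
    (h : ∀ s t, HasDerivAt (fun s => F s t) (F' s t) s) (s₀ : ℝ) :
    HasDerivAt (fun s => ∫ t in a..b, F s t) (∫ t in a..b, F' s₀ t) s₀ := by
  obtain ⟨M, hM⟩ := ((isCompact_Icc (a := s₀ - 1) (b := s₀ + 1)).prod
    (isCompact_uIcc (a := a) (b := b))).exists_bound_of_continuousOn hF'.continuousOn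
  refine (intervalIntegral.hasDerivAt_integral_of_dominated_loc_of_deriv_le
    (F := F) (F' := F') (s := Set.Icc (s₀ - 1) (s₀ + 1)) (bound := fun _ => M)
    (Icc_mem_nhds (by linarith) (by linarith))
    (Filter.Eventually.of_forall fun s => (hF s).aestronglyMeasurable)
    ((hF s₀).intervalIntegrable _ _) ?_ ?_ (by simp) ?_).2
  · exact (hF'.comp (Continuous.prodMk_right s₀)).aestronglyMeasurable
  · exact Filter.Eventually.of_forall fun t ht s hs => hM (s, t) ⟨hs, Set.uIoc_subset_uIcc ht⟩
  · exact Filter.Eventually.of_forall fun t _ s _ => h s t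

lemma aux_param {E : Type*} [NormedAddCommGroup E] [NormedSpace ℝ E] [FiniteDimensional ℝ E]
    (a b : ℝ) (m : ℕ) : ∀ (H : E × ℝ → ℂ), ContDiff ℝ m H →
    ContDiff ℝ m (fun x => ∫ t in a..b, H (x, t)) := by
  induction m with
  | zero =>
    intro H hH
    have hH := hH.continuous
    refine contDiff_zero.2 ?_
    exact intervalIntegral.continuous_parametric_intervalIntegral_of_continuous' (f := fun x t => H (x, t)) hH a b
  | succ m ih =>
    intro H hH
    have hH1 : Differentiable ℝ H := hH.differentiable (by simp)
    have hH2 : ContDiff ℝ m (fderiv ℝ H) := hH.fderiv_right (by simp)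
    have hd : ∀ x₀, HasFDerivAt (fun x => ∫ t in a..b, H (x, t))
        (∫ t in a..b, (fderiv ℝ H (x₀, t)).comp (ContinuousLinearMap.inl ℝ E ℝ)) x₀ := by
      intro x₀
      have hc : Continuous (fun q : E × ℝ => (fderiv ℝ H q).comp (ContinuousLinearMap.inl ℝ E ℝ)) :=
        hH2.continuous.clm_comp continuous_const
      have : ProperSpace E := FiniteDimensional.proper ℝ E
      obtain ⟨M, hM⟩ := ((isCompact_closedBall x₀ 1).prod
        (isCompact_uIcc (a := a) (b := b))).exists_bound_of_continuousOn hc.continuousOn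
      refine intervalIntegral.hasFDerivAt_integral_of_dominated_of_fderiv_le
        (F := fun x t => H (x, t))
        (F' := fun x t => (fderiv ℝ H (x, t)).comp (ContinuousLinearMap.inl ℝ E ℝ))
        (s := Metric.closedBall x₀ 1) (bound := fun _ => M)
        (Metric.closedBall_mem_nhds _ one_pos)
        (Filter.Eventually.of_forall fun s =>
          (hH.continuous.comp (Continuous.prodMk_right s)).aestronglyMeasurable)
        ((hH.continuous.comp (Continuous.prodMk_right x₀)).intervalIntegrable _ _) ?_ ?_ (by simp) ?_
      · exact (hc.comp (Continuous.prodMk_right x₀)).aestronglyMeasurable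
      · exact Filter.Eventually.of_forall fun t ht s hs => hM (s, t) ⟨hs, Set.uIoc_subset_uIcc ht⟩
      · exact Filter.Eventually.of_forall fun t _ s _ =>
          (hH1 (s, t)).hasFDerivAt.comp s (hasFDerivAt_prodMk_left s t)
    push_cast
    rw [contDiff_succ_iff_fderiv_apply]
    refine ⟨fun x => (hd x).differentiableAt, by simp, fun w => ?_⟩
    have : (fun x => fderiv ℝ (fun x => ∫ t in a..b, H (x, t)) x w)
        = fun x => ∫ t in a..b, (fun q : E × ℝ => fderiv ℝ H q (w, 0)) (x, t) := by
      ext x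
      rw [(hd x).fderiv, ContinuousLinearMap.intervalIntegral_apply]
      · simp
      · have hc : Continuous (fun q : E × ℝ => (fderiv ℝ H q).comp (ContinuousLinearMap.inl ℝ E ℝ)) :=
          hH2.continuous.clm_comp continuous_const
        exact (hc.comp (Continuous.prodMk_right x)).intervalIntegrable _ _
    rw [this]
    exact ih _ (hH2.clm_apply contDiff_const)

lemma aux_update_contDiff {n : ℕ} (m : ℕ) (i : Fin n) :
    ContDiff ℝ m (fun q : (Fin n → ℝ) × ℝ => Function.update q.1 i q.2) := by
  rw [contDiff_pi]
  intro j
  by_cases hj : j = i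
  · subst hj
    simpa using contDiff_snd
  · simp only [Function.update_of_ne hj]
    exact (contDiff_apply ℝ ℝ j).comp contDiff_fst

def Ci {n : ℕ} (ρ : ℝ → ℝ) (c d : ℝ) (i : Fin n) (g : (Fin n → ℝ) → ℂ) : (Fin n → ℝ) → ℂ :=
  fun x => g x - (ρ (x i) : ℂ) * ∫ y in c..d, g (Function.update x i y)

def Bi {n : ℕ} (c : ℝ) (i : Fin n) (g : (Fin n → ℝ) → ℂ) : (Fin n → ℝ) → ℂ :=
  fun x => -∫ y in c..(x i), g (Function.update x i y)

lemma Ci_contDiff {n : ℕ} (ρ : ℝ → ℝ) (hρ1 : ContDiff ℝ (⊤ : ℕ∞) ρ) (c d : ℝ) (i : Fin n) (m : ℕ)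
    (g : (Fin n → ℝ) → ℂ) (hg : ContDiff ℝ m g) : ContDiff ℝ m (Ci ρ c d i g) := by
  unfold Ci
  refine hg.sub (ContDiff.mul ?_ ?_)
  · have h1 : ContDiff ℝ m ρ := hρ1.of_le (by exact_mod_cast le_top)
    exact Complex.ofRealCLM.contDiff.comp (h1.comp (contDiff_apply ℝ ℝ i))
  · exact aux_param c d m (fun q : (Fin n → ℝ) × ℝ => g (Function.update q.1 i q.2))
      (hg.comp (aux_update_contDiff m i))

lemma Bi_contDiff {n : ℕ} (c : ℝ) (i : Fin n) (m : ℕ)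
    (g : (Fin n → ℝ) → ℂ) (hg : ContDiff ℝ m g) : ContDiff ℝ m (Bi c i g) := by
  have e : Bi c i g = fun x => -((x i - c) • ∫ t in (0:ℝ)..1,
      (fun q : (Fin n → ℝ) × ℝ => g (Function.update q.1 i (c + (q.1 i - c) * q.2))) (x, t)) := by
    ext x
    simp only [Bi]
    have := intervalIntegral.smul_integral_comp_add_mul (a := 0) (b := 1)
      (fun y => g (Function.update x i y)) (x i - c) c
    rw [this]
    simp
  rw [e]
  have hx : ContDiff ℝ m (fun x : Fin n → ℝ => x i) := contDiff_apply ℝ ℝ i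
  refine ContDiff.neg (ContDiff.smul (hx.sub contDiff_const) (aux_param 0 1 m
    (fun q : (Fin n → ℝ) × ℝ => g (Function.update q.1 i (c + (q.1 i - c) * q.2))) ?_))
  refine hg.comp ((aux_update_contDiff m i).comp (contDiff_fst.prodMk ?_))
  exact contDiff_const.add (((hx.comp contDiff_fst).sub contDiff_const).mul contDiff_snd)

lemma hasLine_shift {n : ℕ} {g g' : (Fin n → ℝ) → ℂ} {v : Fin n → ℝ}
    (h : ∀ x, HasLineDerivAt ℝ g (g' x) x v) (x : Fin n → ℝ) (s : ℝ) :
    HasDerivAt (fun s : ℝ => g (x + s • v)) (g' (x + s • v)) s := by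
  have h1 : HasDerivAt (fun t : ℝ => g ((x + s • v) + t • v)) (g' (x + s • v)) (s - s) := by
    rw [sub_self]; exact h (x + s • v)
  have h4 := HasDerivAt.scomp (h := fun t : ℝ => t - s) s h1 ((hasDerivAt_id s).sub_const s)
  rw [one_smul] at h4
  refine h4.congr_of_eventuallyEq (Filter.Eventually.of_forall fun t => ?_)
  simp only [Function.comp, id]
  congr 1
  module

lemma update_line {n : ℕ} {i j : Fin n} (hij : j ≠ i) (x : Fin n → ℝ) (s y : ℝ) :
    Function.update (x + s • (Pi.single j 1 : Fin n → ℝ)) i y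
      = Function.update x i y + s • (Pi.single j 1 : Fin n → ℝ) := by
  ext k
  by_cases hk : k = i
  · subst hk
    simp [hij.symm]
  · simp [hk]

lemma aux_line_update {n : ℕ} {i j : Fin n} (hij : j ≠ i) {g g' : (Fin n → ℝ) → ℂ}
    (hg : Continuous g) (hg' : Continuous g')
    (h : ∀ x, HasLineDerivAt ℝ g (g' x) x (Pi.single j 1)) (a b : ℝ) (x : Fin n → ℝ) :
    HasLineDerivAt ℝ (fun x => ∫ y in a..b, g (Function.update x i y))
      (∫ y in a..b, g' (Function.update x i y)) x (Pi.single j 1) := by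
  have hu : Continuous (fun q : (Fin n → ℝ) × ℝ => Function.update q.1 i q.2) :=
    (aux_update_contDiff 0 i).continuous
  have := aux_line_int a b
    (fun s y => g (Function.update x i y + s • (Pi.single j 1 : Fin n → ℝ)))
    (fun s y => g' (Function.update x i y + s • (Pi.single j 1 : Fin n → ℝ)))
    (fun s => hg.comp ((hu.comp (Continuous.prodMk_right x)).add continuous_const))
    (hg'.comp (((hu.comp (Continuous.prodMk_right x)).comp continuous_snd).add
      (continuous_fst.smul continuous_const)))
    (fun s t => hasLine_shift h _ s) 0
  unfold HasLineDerivAt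
  simpa only [update_line hij, zero_smul, add_zero] using this

lemma Ci_line {n : ℕ} (ρ : ℝ → ℝ) (c d : ℝ) {i j : Fin n} (hij : j ≠ i) {g g' : (Fin n → ℝ) → ℂ}
    (hg : Continuous g) (hg' : Continuous g')
    (h : ∀ x, HasLineDerivAt ℝ g (g' x) x (Pi.single j 1)) (x : Fin n → ℝ) :
    HasLineDerivAt ℝ (Ci ρ c d i g) (Ci ρ c d i g' x) x (Pi.single j 1) := by
  have h1 := aux_line_update hij hg hg' h c d x
  have h2 := h x
  unfold HasLineDerivAt at *
  have h3 := h2.sub (h1.const_mul (ρ (x i) : ℂ))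
  refine h3.congr_of_eventuallyEq (Filter.Eventually.of_forall fun s => ?_)
  simp [Ci, hij.symm]

lemma Bi_line {n : ℕ} (c : ℝ) {i j : Fin n} (hij : j ≠ i) {g g' : (Fin n → ℝ) → ℂ}
    (hg : Continuous g) (hg' : Continuous g')
    (h : ∀ x, HasLineDerivAt ℝ g (g' x) x (Pi.single j 1)) (x : Fin n → ℝ) :
    HasLineDerivAt ℝ (Bi c i g) (Bi c i g' x) x (Pi.single j 1) := by
  have h1 := aux_line_update hij hg hg' h c (x i) x
  unfold HasLineDerivAt at *
  refine h1.neg.congr_of_eventuallyEq (Filter.Eventually.of_forall fun s => ?_)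
  simp [Bi, hij.symm]

lemma Bi_self {n : ℕ} (c : ℝ) (i : Fin n) {g : (Fin n → ℝ) → ℂ}
    (hg : Continuous g) (x : Fin n → ℝ) :
    HasLineDerivAt ℝ (Bi c i g) (- g x) x (Pi.single i 1) := by
  have hu : Continuous (fun y : ℝ => g (Function.update x i y)) :=
    hg.comp ((aux_update_contDiff 0 i).continuous.comp (Continuous.prodMk_right x))
  have h0 : HasDerivAt (fun u => ∫ y in c..u, g (Function.update x i y))
      (g (Function.update x i (x i + 0))) (x i + 0) :=
    intervalIntegral.integral_hasDerivAt_right (hu.intervalIntegrable _ _)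
      (hu.stronglyMeasurableAtFilter _ _) hu.continuousAt
  have h1 := (h0.scomp (0 : ℝ) ((hasDerivAt_id (0:ℝ)).const_add (x i))).neg
  unfold HasLineDerivAt
  simp only [add_zero, Function.update_eq_self, one_smul] at h1
  refine h1.congr_of_eventuallyEq (Filter.Eventually.of_forall fun s => ?_)
  have : ∀ y, Function.update (x + s • (Pi.single i 1 : Fin n → ℝ)) i y = Function.update x i y := by
    intro y
    ext k
    by_cases hk : k = i
    · subst hk; simp
    · simp [hk]
  simp [Bi, this]

/-- vanishing outside the cube -/
def Van {n : ℕ} (c d : ℝ) (g : (Fin n → ℝ) → ℂ) : Prop :=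
  ∀ x : Fin n → ℝ, x ∉ Set.univ.pi (fun _ : Fin n => Set.Icc c d) → g x = 0

lemma Van.coord {n : ℕ} {c d : ℝ} {g : (Fin n → ℝ) → ℂ} (h : Van c d g) (x : Fin n → ℝ) (j : Fin n)
    (hj : x j ∉ Set.Icc c d) : g x = 0 :=
  h x fun hx => hj (hx j (Set.mem_univ j))

lemma integral_eq_Icc (f : ℝ → ℂ) (c d : ℝ) (hcd : c ≤ d) (hf : ∀ y, y ∉ Set.Icc c d → f y = 0) :
    ∫ y, f y = ∫ y in c..d, f y := by
  rw [intervalIntegral.integral_of_le hcd, ← integral_Icc_eq_integral_Ioc,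
    setIntegral_eq_integral_of_forall_compl_eq_zero hf]

lemma Cop_eq {n : ℕ} (ρ : ℝ → ℝ) (c d : ℝ) (hcd : c ≤ d) (i : Fin n) (g : (Fin n → ℝ) → ℂ)
    (hg : Van c d g) : Cop ρ i g = Ci ρ c d i g := by
  ext x
  unfold Cop Ci
  rw [integral_eq_Icc _ c d hcd]
  intro y hy
  exact hg.coord _ i (by simpa using hy)

lemma rho_zero {ρ : ℝ → ℝ} {c d : ℝ} (hKρ : tsupport ρ ⊆ Set.Icc c d) (y : ℝ)
    (hy : y ∉ Set.Icc c d) : ρ y = 0 :=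
  image_eq_zero_of_notMem_tsupport fun h => hy (hKρ h)

lemma Cop_van {n : ℕ} (ρ : ℝ → ℝ) (c d : ℝ) (hKρ : tsupport ρ ⊆ Set.Icc c d)
    (i : Fin n) (g : (Fin n → ℝ) → ℂ)
    (hg : Van c d g) : Van c d (Cop ρ i g) := by
  intro x hx
  have h0 := hg x hx
  simp only [Set.mem_univ_pi, not_forall] at hx
  obtain ⟨j, hj⟩ := hx
  unfold Cop
  rw [h0]
  by_cases hji : j = i
  · subst hji
    simp [rho_zero hKρ _ hj]
  · have : ∀ y, g (Function.update x i y) = 0 := fun y => hg.coord _ j (by simpa [hji] using hj)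
    simp [this]

lemma Bop_eq {n : ℕ} (c d : ℝ) (i : Fin n) (g : (Fin n → ℝ) → ℂ)
    (hgc : Continuous g) (hg : Van c d g) : Bop i g = Bi c i g := by
  ext x
  unfold Bop Bi
  congr 1
  have hu : Continuous (fun y : ℝ => g (Function.update x i y)) :=
    hgc.comp ((aux_update_contDiff 0 i).continuous.comp (Continuous.prodMk_right x))
  have hz : ∀ y, y ∉ Set.Icc c d → g (Function.update x i y) = 0 := fun y hy =>
    hg.coord _ i (by simpa using hy)
  have hi : Integrable (fun y : ℝ => g (Function.update x i y)) :=
    hu.integrable_of_hasCompactSupport (HasCompactSupport.intro isCompact_Icc hz)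
  rw [← intervalIntegral.integral_Iic_sub_Iic hi.integrableOn hi.integrableOn]
  have : ∫ y in Set.Iic c, g (Function.update x i y) = 0 := by
    rw [integral_Iic_eq_integral_Iio]
    refine setIntegral_eq_zero_of_forall_eq_zero fun y hy => hz y fun h => ?_
    exact absurd h.1 (not_le.2 hy)
  rw [this, sub_zero]

lemma Aop_van {n : ℕ} (ρ : ℝ → ℝ) (hρ1 : ContDiff ℝ (⊤ : ℕ∞) ρ) (hρ3 : ∫ t : ℝ, ρ t = 1)
    (c d : ℝ) (hcd : c ≤ d) (hKρ : tsupport ρ ⊆ Set.Icc c d)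
    (i : Fin n) (g : (Fin n → ℝ) → ℂ) (hgc : Continuous g)
    (hg : Van c d g) : Van c d (Aop' ρ i g) := by
  have hC := Cop_van ρ c d hKρ i g hg
  have hCc : Continuous (Cop ρ i g) := by
    rw [Cop_eq ρ c d hcd i g hg]
    exact (Ci_contDiff ρ hρ1 c d i 0 g (contDiff_zero.2 hgc)).continuous
  intro x hx
  simp only [Set.mem_univ_pi, not_forall] at hx
  obtain ⟨j, hj⟩ := hx
  unfold Aop' Bop
  rw [neg_eq_zero]
  by_cases hji : j = i
  · subst hji
    have hu : ∀ h : (Fin n → ℝ) → ℂ, Continuous h →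
        Continuous (fun y : ℝ => h (Function.update x j y)) := fun h hh =>
      hh.comp ((aux_update_contDiff 0 j).continuous.comp (Continuous.prodMk_right x))
    have hz : ∀ y, y ∉ Set.Icc c d → Cop ρ j g (Function.update x j y) = 0 := fun y hy =>
      hC.coord _ j (by simpa using hy)
    by_cases hlt : x j < c
    · refine setIntegral_eq_zero_of_forall_eq_zero fun y hy => hz y fun h => ?_
      exact absurd (h.1.trans hy) (not_le.2 hlt)
    · have hgt : d < x j := by
        by_contra hcon
        exact hj ⟨not_lt.1 hlt, not_lt.1 hcon⟩
      rw [setIntegral_eq_integral_of_forall_compl_eq_zero (s := Set.Iic (x j))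
        (fun y hy => hz y fun h => hy (h.2.trans hgt.le))]
      unfold Cop
      simp only [Function.update_self, Function.update_idem]
      have hρi : Integrable (fun y => (ρ y : ℂ)) := by
        refine Continuous.integrable_of_hasCompactSupport
          (Complex.continuous_ofReal.comp hρ1.continuous)
          (HasCompactSupport.intro (isCompact_Icc (a := c) (b := d)) fun y hy => ?_)
        simp [rho_zero hKρ y hy]
      rw [integral_sub, integral_mul_const, integral_complex_ofReal, hρ3]
      · simp
      · exact (hu g hgc).integrable_of_hasCompactSupport
          (HasCompactSupport.intro (isCompact_Icc (a := c) (b := d)) fun y hy =>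
            hg.coord _ j (by simpa using hy))
      · exact hρi.mul_const _
  · refine setIntegral_eq_zero_of_forall_eq_zero fun y _ => hC.coord _ j (by simpa [hji] using hj)

def PP {n : ℕ} (c d : ℝ) (m : ℕ) (S : List (Fin n)) (g : (Fin n → ℝ) → ℂ) : Prop :=
  ContDiff ℝ m g ∧ Van c d g ∧ ∀ j ∈ S, ∃ g' : (Fin n → ℝ) → ℂ, ContDiff ℝ m g' ∧
    ∀ x, HasLineDerivAt ℝ g (g' x) x (Pi.single j 1)

lemma PP_step {n : ℕ} (ρ : ℝ → ℝ) (hρ1 : ContDiff ℝ (⊤ : ℕ∞) ρ) (hρ3 : ∫ t : ℝ, ρ t = 1)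
    (c d : ℝ) (hcd : c ≤ d) (hKρ : tsupport ρ ⊆ Set.Icc c d) (m : ℕ)
    (i : Fin n) (S : List (Fin n)) (g : (Fin n → ℝ) → ℂ) (h : PP c d m S g) :
    PP c d m (i :: S) (Aop' ρ i g) := by
  obtain ⟨hg, hv, hS⟩ := h
  have hCc := Ci_contDiff ρ hρ1 c d i m g hg
  have e : Aop' ρ i g = Bi c i (Ci ρ c d i g) := by
    unfold Aop'
    have h1 := Cop_van ρ c d hKρ i g hv
    rw [Cop_eq ρ c d hcd i g hv] at h1 ⊢
    exact Bop_eq c d i _ hCc.continuous h1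
  refine ⟨?_, Aop_van ρ hρ1 hρ3 c d hcd hKρ i g hg.continuous hv, ?_⟩
  · rw [e]; exact Bi_contDiff c i m _ hCc
  · intro j hj
    rw [e]
    by_cases hji : j = i
    · subst hji
      exact ⟨_, hCc.neg, fun x => Bi_self c j hCc.continuous x⟩
    · have hj' : j ∈ S := by simpa [hji] using hj
      obtain ⟨g', hg', hl⟩ := hS j hj'
      have hCc' := Ci_contDiff ρ hρ1 c d i m g' hg'
      exact ⟨_, Bi_contDiff c i m _ hCc', fun x => Bi_line c hji hCc.continuous hCc'.continuous
        (Ci_line ρ c d hji hg.continuous hg'.continuous hl) x⟩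

/-- with `ρ` a smooth compactly supported function of integral 1 and `K₀ = [c,d]`
a compact interval containing the support of `ρ`: if `g : ℝ^n → ℂ` is of class `C^m` and
vanishes outside `K₀^n`, then `A'(g)` is of class `C^{m+1}` and vanishes outside `K₀^n`. -/
theorem stmt9 {n : ℕ} (ρ : ℝ → ℝ)
    (hρ1 : ContDiff ℝ (⊤ : ℕ∞) ρ) (hρ2 : HasCompactSupport ρ) (hρ3 : ∫ t : ℝ, ρ t = 1)
    (c d : ℝ) (hcd : c ≤ d) (hKρ : tsupport ρ ⊆ Set.Icc c d)
    (m : ℕ) (g : (Fin n → ℝ) → ℂ) (hg : ContDiff ℝ m g)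
    (hgsupp : ∀ x : Fin n → ℝ,
      x ∉ Set.univ.pi (fun _ : Fin n => Set.Icc c d) → g x = 0) :
    ContDiff ℝ (m + 1) (Aop'full ρ g) ∧
    ∀ x : Fin n → ℝ,
      x ∉ Set.univ.pi (fun _ : Fin n => Set.Icc c d) → Aop'full ρ g x = 0 := by
  have key : ∀ l : List (Fin n), PP c d m l (l.foldr (fun i acc => Aop' ρ i acc) g) := by
    intro l
    induction l with
    | nil => exact ⟨hg, hgsupp, fun j hj => by simp at hj⟩
    | cons i l ih => exact PP_step ρ hρ1 hρ3 c d hcd hKρ m i l _ ih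
  obtain ⟨_, hv, hS⟩ := key (List.finRange n)
  refine ⟨?_, hv⟩
  choose p hp hl using fun j => hS j (List.mem_finRange j)
  exact aux_contDiff_succ m _ p hp hl

end
end

section
/- With ρ and the operator A' = A_1'∘⋯∘A_n' as in the context: let K_0 ⊆ ℝ be a compact interval containing the support of ρ, and let g : ℝ^n → ℂ be measurable and bounded with g(x) = 0 for all x outside K_0^n. Then A'(g) is continuous on ℝ^n and A'(g)(x) = 0 for all x outside K_0^n. -/
open Complex Real MeasureTheory Set

noncomputable section

lemma aux_J {c d M : ℝ} (hcd : c ≤ d) {f : ℝ → ℂ} (hf : Measurable f) (hM : ∀ y, ‖f y‖ ≤ M)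
    (h0 : ∀ y, y ∉ Set.Icc c d → f y = 0) :
    Integrable f ∧ ∀ S : Set ℝ, MeasurableSet S → ‖∫ y in S, f y‖ ≤ M * (d - c) := by
  have hM0 : 0 ≤ M := (norm_nonneg _).trans (hM 0)
  have hi : Integrable ((Set.Icc c d).indicator (fun _ : ℝ => M)) := by
    rw [integrable_indicator_iff measurableSet_Icc]
    exact integrableOn_const (by simp)
  have hle : ∀ y, ‖f y‖ ≤ (Set.Icc c d).indicator (fun _ : ℝ => M) y := by
    intro y
    by_cases hy : y ∈ Set.Icc c d
    · simp only [Set.indicator_of_mem hy]; exact hM y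
    · simp [h0 y hy]
      exact Set.indicator_nonneg (fun _ _ => hM0) y
  have hfi : Integrable f := hi.mono' hf.aestronglyMeasurable (Filter.Eventually.of_forall hle)
  refine ⟨hfi, fun S hS => ?_⟩
  calc ‖∫ y in S, f y‖ ≤ ∫ y in S, (Set.Icc c d).indicator (fun _ : ℝ => M) y :=
        norm_integral_le_of_norm_le hi.integrableOn (Filter.Eventually.of_forall hle)
    _ ≤ ∫ y, (Set.Icc c d).indicator (fun _ : ℝ => M) y :=
        setIntegral_le_integral hi
          (Filter.Eventually.of_forall fun y => Set.indicator_nonneg (fun _ _ => hM0) y)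
    _ = M * (d - c) := by
        rw [integral_indicator measurableSet_Icc, setIntegral_const]
        simp [measureReal_def, hcd, mul_comm]

lemma aux_inc {M : ℝ} {f : ℝ → ℂ} (hf : Integrable f) (hM : ∀ y, ‖f y‖ ≤ M) (s t : ℝ) :
    ‖(∫ y in Set.Iic s, f y) - ∫ y in Set.Iic t, f y‖ ≤ M * |s - t| := by
  rw [intervalIntegral.integral_Iic_sub_Iic hf.integrableOn hf.integrableOn]
  exact intervalIntegral.norm_integral_le_of_norm_le_const (fun y _ => hM y)

lemma aux_meas {α : Type*} [MeasurableSpace α] {u : α → ℝ} (hu : Measurable u) {F : α → ℝ → ℂ}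
    (hF : Measurable (Function.uncurry F)) :
    Measurable (fun x => ∫ y in Set.Iic (u x), F x y) := by
  have h1 : MeasurableSet {p : α × ℝ | p.2 ≤ u p.1} :=
    measurableSet_le measurable_snd (hu.comp measurable_fst)
  have h2 : StronglyMeasurable
      (Set.indicator {p : α × ℝ | p.2 ≤ u p.1} (Function.uncurry F)) :=
    (hF.indicator h1).stronglyMeasurable
  have h3 := (h2.integral_prod_right' (ν := (volume : Measure ℝ))).measurable
  convert h3 using 2 with x
  rw [← integral_indicator measurableSet_Iic]
  rfl

lemma aux_upd {n : ℕ} (i : Fin n) :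
    Measurable (fun p : (Fin n → ℝ) × ℝ => Function.update p.1 i p.2) := by
  rw [measurable_pi_iff]
  intro j
  by_cases h : j = i
  · subst h; simpa using measurable_snd
  · simp only [Function.update_of_ne h]; exact (measurable_pi_apply j).comp measurable_fst

lemma aux_form {n : ℕ} (ρ : ℝ → ℝ) (i : Fin n) (g : (Fin n → ℝ) → ℂ) (x : Fin n → ℝ)
    (hr : Integrable (fun y => (ρ y : ℂ)))
    (hg : Integrable (fun y => g (Function.update x i y))) :
    Aop' ρ i g x = (∫ y in Set.Iic (x i), (ρ y : ℂ)) * (∫ y, g (Function.update x i y))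
      - ∫ y in Set.Iic (x i), g (Function.update x i y) := by
  simp only [Aop', Bop, Cop, Function.update_self, Function.update_idem]
  rw [integral_sub hg.integrableOn (hr.mul_const _).integrableOn, integral_mul_const]
  ring

def AuxInv {n : ℕ} (c d : ℝ) (l : List (Fin n)) (g : (Fin n → ℝ) → ℂ) : Prop :=
  Measurable g ∧ (∃ M : ℝ, ∀ x, ‖g x‖ ≤ M) ∧
  (∀ x : Fin n → ℝ, x ∉ Set.univ.pi (fun _ : Fin n => Set.Icc c d) → g x = 0) ∧
  ∃ L : ℝ, 0 ≤ L ∧ ∀ x x' : Fin n → ℝ, (∀ j, j ∉ l → x j = x' j) → ‖g x - g x'‖ ≤ L * dist x x'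

lemma aux_step {n : ℕ} (ρ : ℝ → ℝ)
    (hρ1 : Continuous ρ) (hρ2 : HasCompactSupport ρ) (hρ3 : ∫ t : ℝ, ρ t = 1)
    (c d : ℝ) (hcd : c ≤ d) (hKρ : tsupport ρ ⊆ Set.Icc c d) (l : List (Fin n)) (i : Fin n)
    (g : (Fin n → ℝ) → ℂ) (h : AuxInv c d l g) : AuxInv c d (i :: l) (Aop' ρ i g) := by
  obtain ⟨hm, ⟨M, hM⟩, hs, L, hL0, hL⟩ := h
  have hrm : Measurable (fun y => (ρ y : ℂ)) := Complex.measurable_ofReal.comp hρ1.measurable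
  have hr0 : ∀ y, y ∉ Set.Icc c d → (ρ y : ℂ) = 0 := fun y hy => by
    rw [image_eq_zero_of_notMem_tsupport (fun h => hy (hKρ h))]; simp
  obtain ⟨N, hN'⟩ := hρ2.exists_bound_of_continuous hρ1
  have hN : ∀ y, ‖(ρ y : ℂ)‖ ≤ N := fun y => by simpa using hN' y
  obtain ⟨hri, hrJ⟩ := aux_J hcd hrm hN hr0
  have hN0 : 0 ≤ N := (norm_nonneg _).trans (hN 0)
  have hM0 : 0 ≤ M := (norm_nonneg _).trans (hM 0)
  have hdc : 0 ≤ d - c := by linarith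
  have hr1 : ∫ y, (ρ y : ℂ) = 1 := by rw [integral_complex_ofReal, hρ3]; simp
  have hfm : ∀ x, Measurable (fun y => g (Function.update x i y)) := fun x =>
    hm.comp ((aux_upd i).comp (measurable_const.prodMk measurable_id))
  have hf0 : ∀ x, ∀ y, y ∉ Set.Icc c d → g (Function.update x i y) = 0 := fun x y hy => by
    apply hs
    intro h
    exact hy (by simpa using h i (Set.mem_univ i))
  have hfJ := fun x => aux_J hcd (hfm x) (fun y => hM _) (hf0 x)
  have hform := fun x => aux_form ρ i g x hri (hfJ x).1
  have hfU : ∀ x, ‖∫ y, g (Function.update x i y)‖ ≤ M * (d - c) := fun x => by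
    simpa using (hfJ x).2 Set.univ MeasurableSet.univ
  refine ⟨?_, ⟨N * (d - c) * (M * (d - c)) + M * (d - c), fun x => ?_⟩, fun x hx => ?_,
    N * (M * (d - c)) + N * (d - c) * (L * (d - c)) + (M + L * (d - c)), by positivity,
    fun x x' hxx => ?_⟩
  · have hF : Measurable (Function.uncurry fun (x : Fin n → ℝ) (y : ℝ) =>
        g (Function.update x i y)) := hm.comp (aux_upd i)
    have h1 := aux_meas (measurable_pi_apply i) hF
    have h2 := aux_meas (measurable_pi_apply (X := fun _ : Fin n => ℝ) i)
      (F := fun _ y => (ρ y : ℂ)) (hrm.comp measurable_snd)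
    have h3 := (hF.stronglyMeasurable.integral_prod_right (ν := (volume : Measure ℝ))).measurable
    rw [funext hform]
    exact (h2.mul h3).sub h1
  · rw [hform]
    refine (norm_sub_le _ _).trans (add_le_add ?_ ((hfJ x).2 _ measurableSet_Iic))
    rw [norm_mul]
    exact mul_le_mul (hrJ _ measurableSet_Iic) (hfU x) (norm_nonneg _) (by positivity)
  · rw [hform]
    by_cases hxi : x i ∈ Set.Icc c d
    · have : ∀ y, g (Function.update x i y) = 0 := by
        intro y
        apply hs
        intro h
        apply hx
        intro j _
        by_cases hj : j = i
        · subst hj; exact hxi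
        · have := h j (Set.mem_univ j)
          simpa [hj] using this
      simp [this]
    · by_cases hlt : x i < c
      · have key : ∀ f : ℝ → ℂ, (∀ y, y ∉ Set.Icc c d → f y = 0) →
            ∫ y in Set.Iic (x i), f y = 0 := fun f hf =>
          setIntegral_eq_zero_of_forall_eq_zero fun y hy => hf y fun h => by
            have h1 := h.1
            have h2 : y ≤ x i := hy
            linarith
        rw [key _ hr0, key _ (hf0 x)]; simp
      · have hgt : d < x i := by
          by_contra hh
          exact hxi ⟨not_lt.1 hlt, not_lt.1 hh⟩
        have key : ∀ f : ℝ → ℂ, (∀ y, y ∉ Set.Icc c d → f y = 0) →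
            ∫ y in Set.Iic (x i), f y = ∫ y, f y := fun f hf =>
          setIntegral_eq_integral_of_forall_compl_eq_zero fun y hy => hf y fun h => by
            have h1 := h.2
            exact hy (show y ≤ x i by linarith)
        rw [key _ hr0, key _ (hf0 x), hr1]; simp
  · rw [hform, hform]
    set D := dist x x' with hD
    have hD0 : 0 ≤ D := dist_nonneg
    have hi : |x i - x' i| ≤ D := by rw [← Real.dist_eq]; exact dist_le_pi_dist x x' i
    have hdiff : ∀ y, ‖g (Function.update x i y) - g (Function.update x' i y)‖ ≤ L * D := by
      intro y
      refine (hL _ _ fun j hj => ?_).trans (mul_le_mul_of_nonneg_left ?_ hL0)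
      · by_cases hji : j = i
        · subst hji; simp
        · simp only [Function.update_of_ne hji]
          exact hxx j (by simp [hji, hj])
      · rw [dist_pi_le_iff hD0]
        intro j
        by_cases hji : j = i
        · subst hji; simpa using hD0
        · simp only [Function.update_of_ne hji]
          exact dist_le_pi_dist x x' j
    have hdJ := (aux_J hcd ((hfm x).sub (hfm x')) hdiff
      (fun y hy => by simp [hf0 x y hy, hf0 x' y hy])).2
    have e1 := aux_inc hri hN (x i) (x' i)
    have e2 := aux_inc (hfJ x).1 (fun y => hM _) (x i) (x' i)
    have e3 := hdJ _ (measurableSet_Iic (a := x' i))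
    have e4 := hdJ _ MeasurableSet.univ
    have e5 := hrJ _ (measurableSet_Iic (a := x' i))
    have e6 := hfU x
    simp only [Pi.sub_apply] at e3 e4
    rw [integral_sub (hfJ x).1.integrableOn (hfJ x').1.integrableOn] at e3 e4
    simp only [Measure.restrict_univ] at e4
    generalize (∫ y in Set.Iic (x i), (ρ y : ℂ)) = R at *
    generalize (∫ y in Set.Iic (x' i), (ρ y : ℂ)) = R' at *
    generalize (∫ y in Set.Iic (x i), g (Function.update x i y)) = P at *
    generalize (∫ y in Set.Iic (x' i), g (Function.update x' i y)) = P' at *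
    generalize (∫ y in Set.Iic (x' i), g (Function.update x i y)) = Q at *
    generalize (∫ y, g (Function.update x i y)) = G at *
    generalize (∫ y, g (Function.update x' i y)) = G' at *
    have e1' : ‖R - R'‖ ≤ N * D := e1.trans (mul_le_mul_of_nonneg_left hi hN0)
    have e2' : ‖P - Q‖ ≤ M * D := e2.trans (mul_le_mul_of_nonneg_left hi hM0)
    have a1 : ‖(R - R') * G‖ ≤ N * D * (M * (d - c)) := by
      rw [norm_mul]; exact mul_le_mul e1' e6 (norm_nonneg _) (by positivity)
    have a2 : ‖R' * (G - G')‖ ≤ N * (d - c) * (L * D * (d - c)) := by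
      rw [norm_mul]; exact mul_le_mul e5 e4 (norm_nonneg _) (by positivity)
    calc ‖R * G - P - (R' * G' - P')‖
        = ‖((R - R') * G + R' * (G - G')) - ((P - Q) + (Q - P'))‖ := by congr 1; ring
      _ ≤ (‖(R - R') * G‖ + ‖R' * (G - G')‖) + (‖P - Q‖ + ‖Q - P'‖) :=
          (norm_sub_le _ _).trans (add_le_add (norm_add_le _ _) (norm_add_le _ _))
      _ ≤ (N * D * (M * (d - c)) + N * (d - c) * (L * D * (d - c)))
          + (M * D + L * D * (d - c)) := by gcongr
      _ = _ := by ring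

/-- with `ρ` a smooth compactly supported function of integral 1 and
`K₀ = [c,d]` a compact interval containing the support of `ρ`: if `g : ℝ^n → ℂ` is
measurable and bounded with `g = 0` outside `K₀^n`, then `A'(g)` is continuous and
vanishes outside `K₀^n`. -/
theorem stmt10 {n : ℕ} (ρ : ℝ → ℝ)
    (hρ1 : ContDiff ℝ (⊤ : ℕ∞) ρ) (hρ2 : HasCompactSupport ρ) (hρ3 : ∫ t : ℝ, ρ t = 1)
    (c d : ℝ) (hcd : c ≤ d) (hKρ : tsupport ρ ⊆ Set.Icc c d)
    (g : (Fin n → ℝ) → ℂ) (hmeas : Measurable g) (hbdd : ∃ M : ℝ, ∀ x, ‖g x‖ ≤ M)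
    (hgsupp : ∀ x : Fin n → ℝ,
      x ∉ Set.univ.pi (fun _ : Fin n => Set.Icc c d) → g x = 0) :
    Continuous (Aop'full ρ g) ∧
    ∀ x : Fin n → ℝ,
      x ∉ Set.univ.pi (fun _ : Fin n => Set.Icc c d) → Aop'full ρ g x = 0 := by
  have key : ∀ l : List (Fin n), AuxInv c d l (l.foldr (fun i acc => Aop' ρ i acc) g) := by
    intro l
    induction l with
    | nil =>
      refine ⟨hmeas, hbdd, hgsupp, 0, le_rfl, fun x x' h => ?_⟩
      have : x = x' := funext fun j => h j (by simp)
      simp [this]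
    | cons i l ih => exact aux_step ρ hρ1.continuous hρ2 hρ3 c d hcd hKρ l i _ ih
  obtain ⟨-, -, hs, L, hL0, hL⟩ := key (List.finRange n)
  refine ⟨?_, hs⟩
  have : LipschitzWith ⟨L, hL0⟩ (Aop'full ρ g) := LipschitzWith.of_dist_le_mul fun x x' => by
    rw [dist_eq_norm]
    exact hL x x' fun j hj => absurd (List.mem_finRange j) hj
  exact this.continuous

end
end

section
/- Let n ≥ 1 and let u : 𝒮(ℝ^n, ℂ) → ℂ be a tempered distribution (a continuous linear functional on the Schwartz space). Let Z ⊆ ℝ^n be a set, let f : ℝ^n → ℝ be a polynomial function vanishing at every point of Z, and let N ∈ ℕ. Assume that u(g) = 0 for every Schwartz function g such that for all k ≤ N and all z ∈ Z the k-th iterated derivative of g at z is zero. Then u(g) = 0 for every Schwartz function g of the form g(x) = f(x)^{N+1}·h(x) with h a Schwartz function; that is, the tempered distribution f^{N+1}·u is zero. -/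
open Complex Real MeasureTheory SchwartzMap

theorem aux_vanish {E : Type*} [NormedAddCommGroup E] [NormedSpace ℝ E] (F h : E → ℂ)
    (hF : ContDiff ℝ (⊤ : ℕ∞) F) (hh : ContDiff ℝ (⊤ : ℕ∞) h) (z : E) (hz : F z = 0) (m : ℕ) :
    ∀ k < m, iteratedFDeriv ℝ k (fun x => F x ^ m * h x) z = 0 := by
  induction m with
  | zero => intro k hk; omega
  | succ m ih =>
    intro k hk
    have e : (fun x => F x ^ (m + 1) * h x) = fun x => F x * (F x ^ m * h x) := by
      funext x; ring
    rw [e, ← norm_le_zero_iff]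
    refine (norm_iteratedFDeriv_mul_le (N := ((⊤ : ℕ∞) : WithTop ℕ∞)) hF
      ((hF.pow m).mul hh) z (n := k) (by exact_mod_cast le_top)).trans ?_
    refine (Finset.sum_eq_zero ?_).le
    intro i hi
    rcases Nat.eq_zero_or_pos i with rfl | hi0
    · simp [hz]
    · rw [Finset.mem_range] at hi
      rw [ih (k - i) (by omega)]
      simp

/-- Let `u` be a tempered distribution on `ℝ^n` (a continuous linear
functional on the Schwartz space), `Z ⊆ ℝ^n`, `f` a polynomial function vanishing on `Z`,
and `N ∈ ℕ`. If `u` vanishes on every Schwartz function whose iterated derivatives of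
order `≤ N` vanish at every point of `Z`, then `u` vanishes on every Schwartz function of
the form `x ↦ f(x)^{N+1}·h(x)` with `h` Schwartz; i.e. `f^{N+1}·u = 0`. -/
theorem stmt13 (n : ℕ) (hn : 1 ≤ n)
    (u : SchwartzMap (Fin n → ℝ) ℂ →L[ℂ] ℂ)
    (Z : Set (Fin n → ℝ))
    (p : MvPolynomial (Fin n) ℝ) (f : (Fin n → ℝ) → ℝ)
    (hf : ∀ x, f x = MvPolynomial.eval x p)
    (hfZ : ∀ z ∈ Z, f z = 0) (N : ℕ)
    (hu : ∀ g : SchwartzMap (Fin n → ℝ) ℂ,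
      (∀ k : ℕ, k ≤ N → ∀ z ∈ Z, iteratedFDeriv ℝ k (⇑g) z = 0) → u g = 0) :
    ∀ g h : SchwartzMap (Fin n → ℝ) ℂ,
      (∀ x, g x = ((f x : ℝ) : ℂ) ^ (N + 1) * h x) → u g = 0 := by
  intro g h hg
  apply hu
  intro k hk z hz
  have e : (⇑g) = fun x => ((f x : ℝ) : ℂ) ^ (N + 1) * h x := funext hg
  rw [e]
  have hfs : ContDiff ℝ (⊤ : ℕ∞) f := by
    have : f = fun x => MvPolynomial.eval x p := funext hf
    rw [this]
    clear this hf hfZ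
    induction p using MvPolynomial.induction_on with
    | C a => simpa using contDiff_const
    | add p q hp hq => simpa using hp.add hq
    | mul_X p i hp => simpa using hp.mul (contDiff_apply ℝ ℝ i)
  exact aux_vanish (fun x => ((f x : ℝ) : ℂ)) h (Complex.ofRealCLM.contDiff.comp hfs)
    (h.smooth _) z (by simp [hfZ z hz]) (N + 1) k (by omega)
end
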